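/- arXiv:2605.19557 — 5 statements merged into one kernel-verified Lean document; each statement's English description precedes it below -/
import Mathlib

section
/- Let X be a measurable space, P a probability measure on X, and c ≥ 0 a real deferral cost. Let A, B : X → ℝ be measurable, P-integrable functions (A(x) is the expected loss of the model at x, B(x) the expected loss of the expert at x, i.e. A(x) = E_{Y~η(x)}[ℓ(x,Y,h(x))] and B(x) = E_{Y~η(x)}[ℓ(x,Y,h_exp(x))]). For a measurable rejector r : X → {0,1} define the learning-to-defer objective L(r) = ∫ ((1 − r(x))·A(x) + r(x)·B(x) + c·r(x)) dP(x). Then the rejector r*(x) = 1 if B(x) + c ≤ A(x) and r*(x) = 0 otherwise (i.e. defer exactly when the expected expert loss plus the deferral cost does not exceed the expected model loss) is Bayes optimal: for every measurable r : X → {0,1}, L(r*) ≤ L(r). -/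
open MeasureTheory

/-- The pointwise learning-to-defer loss is integrable for every measurable rejector with
values in `{0, 1}`. -/
theorem integrable_deferral_loss {X : Type*} [MeasurableSpace X] {P : Measure X}
    [IsFiniteMeasure P] {A B r : X → ℝ} (c : ℝ) (hA : Integrable A P) (hB : Integrable B P)
    (hr : Measurable r) (hr01 : ∀ x, r x = 0 ∨ r x = 1) :
    Integrable (fun x ↦ (1 - r x) * A x + r x * B x + c * r x) P := by
  have hmeas : AEStronglyMeasurable (fun x ↦ (1 - r x) * A x + r x * B x + c * r x) P :=
    (((hr.const_sub 1).aestronglyMeasurable.mul hA.aestronglyMeasurable).add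
      (hr.aestronglyMeasurable.mul hB.aestronglyMeasurable)).add
      (hr.const_mul c).aestronglyMeasurable
  refine ((hA.norm.add hB.norm).add (integrable_const |c|)).mono' hmeas (.of_forall fun x ↦ ?_)
  have hBc := abs_add_le (B x) c
  rcases hr01 x with h | h <;> simp [h] <;> linarith [abs_nonneg (A x), abs_nonneg (B x),
    abs_nonneg c]

/-- Chow's rule for post-hoc learning to defer: the rejector that defers exactly when
the expected expert loss plus the deferral cost does not exceed the expected model loss
is Bayes optimal for the learning-to-defer objective. -/
theorem chow_rule_optimal {X : Type*} [MeasurableSpace X]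
    (P : Measure X) [IsProbabilityMeasure P]
    (c : ℝ) (hc : 0 ≤ c)
    (A B : X → ℝ) (hA : Measurable A) (hB : Measurable B)
    (hAi : Integrable A P) (hBi : Integrable B P)
    (r : X → ℝ) (hr : Measurable r) (hr01 : ∀ x, r x = 0 ∨ r x = 1) :
    (∫ x, ((1 - (if B x + c ≤ A x then (1:ℝ) else 0)) * A x
        + (if B x + c ≤ A x then (1:ℝ) else 0) * B x
        + c * (if B x + c ≤ A x then (1:ℝ) else 0)) ∂P)
      ≤ ∫ x, ((1 - r x) * A x + r x * B x + c * r x) ∂P := by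
  have hs : MeasurableSet {x | B x + c ≤ A x} := measurableSet_le (hB.add_const c) hA
  refine integral_mono
    (integrable_deferral_loss c hAi hBi (.ite hs measurable_const measurable_const) fun x ↦ ?_)
    (integrable_deferral_loss c hAi hBi hr hr01) fun x ↦ ?_
  · split_ifs <;> simp
  · rcases hr01 x with h | h <;> simp only [h] <;> split_ifs <;> linarith
end

section
/- Let X be a set, L ≥ 1 a natural number, and η : X → (Fin L → ℝ) a class-posterior (η y x ≥ 0 for all y and ∑_y η y x = 1 for all x). Let ℓ_h, ℓ_e : X × Fin L → ℝ, γ > 0, and Z, Z_e > 0. Define the joint weights w(x) = ∑_y η y x · exp(−ℓ_h(x,y)/γ) and w_e(x) = ∑_y η y x · exp(−ℓ_e(x,y)/γ) (note w_e(x) > 0), and the expert-tilted posterior η̃ y x = η y x · exp(−ℓ_e(x,y)/γ) / w_e(x). Then for every c ∈ ℝ there exists τ > 0 such that for all x: if (w(x)/Z) ≤ τ · (w_e(x)/Z_e) then ∑_y η̃ y x · (ℓ_e(x,y) − ℓ_h(x,y)) ≤ c. That is, whenever the KL-joint density-ratio deferral rule with threshold τ defers at x, Chow's rule with cost c under the expert-tilted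 distribution also defers at x. -/
/-- If the exponential moment of `d` at scale `γ` under the weights `p` is at most `exp (c / γ)`,
then the mean of `d` is at most `c`. -/
theorem sum_mul_le_of_sum_mul_exp_le {ι : Type*} [Fintype ι] {p d : ι → ℝ} {γ c : ℝ}
    (hp0 : ∀ i, 0 ≤ p i) (hp1 : ∑ i, p i = 1) (hγ : 0 < γ)
    (h : ∑ i, p i * Real.exp (d i / γ) ≤ Real.exp (c / γ)) :
    ∑ i, p i * d i ≤ c := by
  have jensen := convexOn_exp.map_sum_le (t := Finset.univ) (w := p) (p := fun i => d i / γ)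
    (fun i _ => hp0 i) hp1 (fun i _ => Set.mem_univ _)
  simp only [smul_eq_mul, ← mul_div_assoc, ← Finset.sum_div] at jensen
  exact (div_le_div_iff_of_pos_right hγ).1 (Real.exp_le_exp.1 (jensen.trans h))

/-- The normalizer of an exponentially tilted probability vector is positive. -/
theorem sum_mul_exp_pos {ι : Type*} [Fintype ι] {p : ι → ℝ} (f : ι → ℝ)
    (hp0 : ∀ i, 0 ≤ p i) (hp1 : ∑ i, p i = 1) :
    0 < ∑ i, p i * Real.exp (f i) := by
  obtain ⟨i, hi, hpi⟩ : ∃ i ∈ Finset.univ, 0 < p i :=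
    Finset.exists_lt_of_sum_lt (by simp [hp1] : ∑ _i : ι, (0 : ℝ) < ∑ i, p i)
  exact Finset.sum_pos' (fun j _ => mul_nonneg (hp0 j) (Real.exp_pos _).le)
    ⟨i, hi, mul_pos hpi (Real.exp_pos _)⟩

/-- Whenever the KL-joint density-ratio deferral rule with threshold `τ` defers at `x`,
Chow's rule with cost `c` under the expert-tilted distribution also defers at `x`. -/
theorem joint_ratio_implies_tilted_chow {X : Type*}
    (L : ℕ) (hL : 1 ≤ L)
    (η : X → Fin L → ℝ) (hη0 : ∀ x y, 0 ≤ η x y) (hη1 : ∀ x, ∑ y, η x y = 1)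
    (ℓh ℓe : X × Fin L → ℝ)
    (γ : ℝ) (hγ : 0 < γ)
    (Z Ze : ℝ) (hZ : 0 < Z) (hZe : 0 < Ze) (c : ℝ) :
    ∃ τ : ℝ, 0 < τ ∧ ∀ x : X,
      ((∑ y, η x y * Real.exp (-(ℓh (x, y)) / γ)) / Z
          ≤ τ * ((∑ y, η x y * Real.exp (-(ℓe (x, y)) / γ)) / Ze)) →
        ∑ y, (η x y * Real.exp (-(ℓe (x, y)) / γ)
            / (∑ y', η x y' * Real.exp (-(ℓe (x, y')) / γ)))
          * (ℓe (x, y) - ℓh (x, y)) ≤ c := by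
  refine ⟨Real.exp (c / γ) * (Ze / Z), by positivity, fun x hx => ?_⟩
  have hw : 0 < ∑ y, η x y * Real.exp (-(ℓe (x, y)) / γ) :=
    sum_mul_exp_pos _ (hη0 x) (hη1 x)
  set w := ∑ y, η x y * Real.exp (-(ℓe (x, y)) / γ)
  refine sum_mul_le_of_sum_mul_exp_le
    (fun y => div_nonneg (mul_nonneg (hη0 x y) (Real.exp_pos _).le) hw.le)
    (by rw [← Finset.sum_div, div_self hw.ne']) hγ ?_
  have tilt (y : Fin L) : η x y * Real.exp (-(ℓe (x, y)) / γ) / w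
      * Real.exp ((ℓe (x, y) - ℓh (x, y)) / γ) = η x y * Real.exp (-(ℓh (x, y)) / γ) / w := by
    rw [div_mul_eq_mul_div, mul_assoc, ← Real.exp_add]
    congr 3
    ring
  simp only [tilt, ← Finset.sum_div]
  rw [div_le_iff₀ hw]
  rw [div_le_iff₀ hZ] at hx
  refine hx.trans_eq ?_
  field_simp
end

section
/- Let X be a measurable space with probability measure P_x, L ≥ 1, and η : X → (Fin L → ℝ) a measurable class-posterior (η y x ≥ 0 for all y and ∑_y η y x = 1 for all x). Let ℓ_h, ℓ_e : X × Fin L → ℝ be measurable with 0 ≤ ℓ_h ≤ Bd and 0 ≤ ℓ_e ≤ Bd for a constant Bd ≥ 0, let γ, γ_e > 0, and let a, b : X → ℝ be measurable, P_x-integrable, with a ≥ 0 and b ≥ 0. Write Ā(x) = ∑_y η y x · ℓ_h(x,y), B̄(x) = ∑_y η y x · ℓ_e(x,y), Var_h(x) = ∑_y η y x · (ℓ_h(x,y) − Ā(x))², Var_e(x) = ∑_y η y x · (ℓ_e(x,y) − B̄(x))². Define L_m = ∫ [exp(−Ā(x)/γ)·a(x) + exp(−B̄(x)/γ_e)·b(x)]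 dP_x and L_j = ∫ [(∑_y η y x·exp(−ℓ_h(x,y)/γ))·a(x) + (∑_y η y x·exp(−ℓ_e(x,y)/γ_e))·b(x)] dP_x. Then (exp(−Bd/γ)/(2γ²))·∫ a·Var_h dP_x + (exp(−Bd/γ_e)/(2γ_e²))·∫ b·Var_e dP_x ≤ L_j − L_m ≤ (1/(2γ²))·∫ a·Var_h dP_x + (1/(2γ_e²))·∫ b·Var_e dP_x. -/
open MeasureTheory

lemma sum_mul_sub_mean_sq {ι : Type*} [Fintype ι] {w : ι → ℝ} (hw : ∑ i, w i = 1) (t : ι → ℝ) :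
    ∑ i, w i * (t i - ∑ j, w j * t j) ^ 2 = ∑ i, w i * t i ^ 2 - (∑ i, w i * t i) ^ 2 := by
  set m := ∑ j, w j * t j with hm
  calc ∑ i, w i * (t i - m) ^ 2
      = ∑ i, (w i * t i ^ 2 - 2 * m * (w i * t i) + m ^ 2 * w i) :=
        Finset.sum_congr rfl fun i _ => by ring
    _ = ∑ i, w i * t i ^ 2 - 2 * m * m + m ^ 2 * 1 := by
        rw [Finset.sum_add_distrib, Finset.sum_sub_distrib, ← Finset.mul_sum, ← Finset.mul_sum,
          ← hm, hw]
    _ = ∑ i, w i * t i ^ 2 - m ^ 2 := by ring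

/-- Jensen's inequality with a quadratic remainder, for a function whose second derivative is
bounded below by `c`. -/
lemma half_mul_variance_le_jensen_gap {ι : Type*} [Fintype ι] {w t : ι → ℝ}
    (hw0 : ∀ i, 0 ≤ w i) (hw : ∑ i, w i = 1) {D : Set ℝ} (hD : Convex ℝ D) (ht : ∀ i, t i ∈ D)
    {f f' f'' : ℝ → ℝ} {c : ℝ} (hf : ∀ x, HasDerivAt f (f' x) x)
    (hf' : ∀ x, HasDerivAt f' (f'' x) x) (hc : ∀ x ∈ D, c ≤ f'' x) :
    c / 2 * ∑ i, w i * (t i - ∑ j, w j * t j) ^ 2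
      ≤ ∑ i, w i * f (t i) - f (∑ i, w i * t i) := by
  have hg : ∀ x, HasDerivAt (fun x => f x - c / 2 * x ^ 2) (f' x - c * x) x := fun x =>
    ((hf x).fun_sub ((hasDerivAt_pow 2 x).const_mul (c / 2))).congr_deriv (by norm_num; ring)
  have hg' : ∀ x, HasDerivAt (fun x => f' x - c * x) (f'' x - c) x := fun x =>
    ((hf' x).fun_sub ((hasDerivAt_id' x).const_mul c)).congr_deriv (by ring)
  have hconv : ConvexOn ℝ D fun x => f x - c / 2 * x ^ 2 :=
    convexOn_of_hasDerivWithinAt2_nonneg hD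
      (fun x _ => (hg x).continuousAt.continuousWithinAt)
      (fun x _ => (hg x).hasDerivWithinAt) (fun x _ => (hg' x).hasDerivWithinAt)
      fun x hx => sub_nonneg.2 (hc x (interior_subset hx))
  have hJ := hconv.map_sum_le (fun i _ => hw0 i) hw fun i (_ : i ∈ Finset.univ) => ht i
  have hsum : ∑ i, w i * (f (t i) - c / 2 * t i ^ 2)
      = ∑ i, w i * f (t i) - c / 2 * ∑ i, w i * t i ^ 2 := by
    rw [Finset.mul_sum, ← Finset.sum_sub_distrib]
    exact Finset.sum_congr rfl fun i _ => by ring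
  simp only [smul_eq_mul, hsum] at hJ
  rw [sum_mul_sub_mean_sq hw]
  linarith

lemma hasDerivAt_mul_exp_neg_div (k γ x : ℝ) :
    HasDerivAt (fun x => k * Real.exp (-x / γ)) (-k / γ * Real.exp (-x / γ)) x :=
  (((hasDerivAt_id' x).fun_neg.div_const γ).exp.const_mul k).congr_deriv (by ring)

lemma exp_jensen_gap_bounds {ι : Type*} [Fintype ι] {w t : ι → ℝ}
    (hw0 : ∀ i, 0 ≤ w i) (hw : ∑ i, w i = 1) {M γ : ℝ} (hγ : 0 < γ)
    (ht : ∀ i, t i ∈ Set.Icc 0 M) :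
    Real.exp (-M / γ) / (2 * γ ^ 2) * ∑ i, w i * (t i - ∑ j, w j * t j) ^ 2
        ≤ ∑ i, w i * Real.exp (-(t i) / γ) - Real.exp (-(∑ i, w i * t i) / γ)
      ∧ ∑ i, w i * Real.exp (-(t i) / γ) - Real.exp (-(∑ i, w i * t i) / γ)
        ≤ 1 / (2 * γ ^ 2) * ∑ i, w i * (t i - ∑ j, w j * t j) ^ 2 := by
  constructor
  · have h := half_mul_variance_le_jensen_gap hw0 hw (convex_Icc 0 M) ht
      (c := Real.exp (-M / γ) / γ ^ 2)
      (hasDerivAt_mul_exp_neg_div 1 γ) (hasDerivAt_mul_exp_neg_div (-1 / γ) γ) fun x hx => by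
        rw [show -(-1 / γ) / γ * Real.exp (-x / γ) = Real.exp (-x / γ) / γ ^ 2 by field_simp]
        have := hx.2
        gcongr
    simp only [one_mul] at h
    convert h using 2
    field_simp
  · have h := half_mul_variance_le_jensen_gap hw0 hw (convex_Icc 0 M) ht (c := -(1 / γ ^ 2))
      (hasDerivAt_mul_exp_neg_div (-1) γ) (hasDerivAt_mul_exp_neg_div (-(-1) / γ) γ)
      fun x hx => by
        rw [show -(-(-1) / γ) / γ * Real.exp (-x / γ) = -(Real.exp (-x / γ) / γ ^ 2) by
          field_simp]
        have : Real.exp (-x / γ) ≤ 1 :=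
          Real.exp_le_one_iff.2 (div_nonpos_of_nonpos_of_nonneg (neg_nonpos.2 hx.1) hγ.le)
        gcongr
    simp only [neg_mul, one_mul, mul_neg, Finset.sum_neg_distrib] at h
    rw [show 1 / (2 * γ ^ 2) = 1 / γ ^ 2 / 2 by field_simp]
    linarith

lemma abs_sum_mul_le {ι : Type*} [Fintype ι] {w t : ι → ℝ}
    (hw0 : ∀ i, 0 ≤ w i) (hw : ∑ i, w i = 1) {K : ℝ} (ht : ∀ i, |t i| ≤ K) :
    |∑ i, w i * t i| ≤ K :=
  calc |∑ i, w i * t i| ≤ ∑ i, |w i * t i| := Finset.abs_sum_le_sum_abs _ _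
    _ ≤ ∑ i, w i * K := Finset.sum_le_sum fun i _ => by
        rw [abs_mul, abs_of_nonneg (hw0 i)]
        exact mul_le_mul_of_nonneg_left (ht i) (hw0 i)
    _ = K := by rw [← Finset.sum_mul, hw, one_mul]

lemma weighted_exp_jensen_gap_integral_bounds {X ι : Type*} [MeasurableSpace X] [Fintype ι]
    [MeasurableSpace ι] [DiscreteMeasurableSpace ι] (μ : Measure X) {η : X → ι → ℝ}
    (hηm : Measurable η) (hη0 : ∀ x y, 0 ≤ η x y) (hη1 : ∀ x, ∑ y, η x y = 1)
    {l : X × ι → ℝ} (hlm : Measurable l) {M : ℝ} (hl : ∀ p, l p ∈ Set.Icc 0 M)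
    {γ : ℝ} (hγ : 0 < γ) {a : X → ℝ} (hai : Integrable a μ) (ha0 : ∀ x, 0 ≤ a x) :
    Integrable (fun x => (∑ y, η x y * Real.exp (-(l (x, y)) / γ)) * a x) μ
    ∧ Integrable (fun x => Real.exp (-(∑ y, η x y * l (x, y)) / γ) * a x) μ
    ∧ Real.exp (-M / γ) / (2 * γ ^ 2)
          * ∫ x, a x * ∑ y, η x y * (l (x, y) - ∑ y', η x y' * l (x, y')) ^ 2 ∂μ
        ≤ ∫ x, (∑ y, η x y * Real.exp (-(l (x, y)) / γ)) * a x ∂μ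
          - ∫ x, Real.exp (-(∑ y, η x y * l (x, y)) / γ) * a x ∂μ
    ∧ ∫ x, (∑ y, η x y * Real.exp (-(l (x, y)) / γ)) * a x ∂μ
          - ∫ x, Real.exp (-(∑ y, η x y * l (x, y)) / γ) * a x ∂μ
        ≤ 1 / (2 * γ ^ 2)
          * ∫ x, a x * ∑ y, η x y * (l (x, y) - ∑ y', η x y' * l (x, y')) ^ 2 ∂μ := by
  have hηy : ∀ y, Measurable fun x => η x y := fun y => (measurable_pi_apply y).comp hηm
  have hly : ∀ y, Measurable fun x => l (x, y) := fun y => hlm.comp measurable_prodMk_right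
  have hmean : Measurable fun x => ∑ y, η x y * l (x, y) :=
    Finset.measurable_fun_sum _ fun y _ => (hηy y).mul (hly y)
  have hexp : ∀ {t : ℝ}, 0 ≤ t → |Real.exp (-t / γ)| ≤ 1 := fun {t} ht => by
    rw [Real.abs_exp]
    exact Real.exp_le_one_iff.2 (div_nonpos_of_nonpos_of_nonneg (neg_nonpos.2 ht) hγ.le)
  have hJ : Integrable (fun x => (∑ y, η x y * Real.exp (-(l (x, y)) / γ)) * a x) μ :=
    hai.bdd_mul (c := 1)
      (Finset.measurable_fun_sum _ fun y _ =>
        (hηy y).mul ((hly y).neg.div_const γ).exp).aestronglyMeasurable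
      (.of_forall fun x => abs_sum_mul_le (hη0 x) (hη1 x) fun y => hexp (hl (x, y)).1)
  have hm0 : ∀ x, 0 ≤ ∑ y, η x y * l (x, y) := fun x =>
    Finset.sum_nonneg fun y _ => mul_nonneg (hη0 x y) (hl (x, y)).1
  have hm1 : ∀ x, ∑ y, η x y * l (x, y) ≤ M := fun x =>
    (le_abs_self _).trans <| abs_sum_mul_le (hη0 x) (hη1 x) fun y => by
      rw [abs_of_nonneg (hl (x, y)).1]
      exact (hl (x, y)).2
  have hE : Integrable (fun x => Real.exp (-(∑ y, η x y * l (x, y)) / γ) * a x) μ :=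
    hai.bdd_mul (c := 1) (hmean.neg.div_const γ).exp.aestronglyMeasurable
      (.of_forall fun x => hexp (hm0 x))
  have hV : Integrable
      (fun x => a x * ∑ y, η x y * (l (x, y) - ∑ y', η x y' * l (x, y')) ^ 2) μ :=
    hai.mul_bdd (c := M ^ 2)
      (Finset.measurable_fun_sum _ fun y _ =>
        (hηy y).mul (((hly y).sub hmean).pow_const 2)).aestronglyMeasurable
      (.of_forall fun x => abs_sum_mul_le (hη0 x) (hη1 x) fun y => by
        rw [abs_pow]
        refine pow_le_pow_left₀ (abs_nonneg _) (abs_le.2 ⟨?_, ?_⟩) 2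
        · linarith [(hl (x, y)).1, hm1 x]
        · linarith [(hl (x, y)).2, hm0 x])
  refine ⟨hJ, hE, ?_, ?_⟩
  · rw [← integral_sub hJ hE, ← integral_const_mul]
    refine integral_mono (hV.const_mul _) (hJ.sub hE) fun x => ?_
    have h := mul_le_mul_of_nonneg_right
      (exp_jensen_gap_bounds (hη0 x) (hη1 x) hγ fun y => hl (x, y)).1 (ha0 x)
    dsimp only
    linarith
  · rw [← integral_sub hJ hE, ← integral_const_mul]
    refine integral_mono (hJ.sub hE) (hV.const_mul _) fun x => ?_
    have h := mul_le_mul_of_nonneg_right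
      (exp_jensen_gap_bounds (hη0 x) (hη1 x) hγ fun y => hl (x, y)).2 (ha0 x)
    dsimp only
    linarith

/-- Quantitative gap between the joint and marginal ideal DR CPE losses in terms of the
conditional variances of the model's and the expert's losses over the label distribution. -/
theorem joint_marginal_gap {X : Type*} [MeasurableSpace X]
    (Px : Measure X) [IsProbabilityMeasure Px]
    (L : ℕ) (hL : 1 ≤ L)
    (η : X → Fin L → ℝ) (hηm : Measurable η)
    (hη0 : ∀ x y, 0 ≤ η x y) (hη1 : ∀ x, ∑ y, η x y = 1)
    (ℓh ℓe : X × Fin L → ℝ) (hℓhm : Measurable ℓh) (hℓem : Measurable ℓe)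
    (Bd : ℝ) (hBd : 0 ≤ Bd)
    (hℓh : ∀ p, ℓh p ∈ Set.Icc 0 Bd) (hℓe : ∀ p, ℓe p ∈ Set.Icc 0 Bd)
    (γ γe : ℝ) (hγ : 0 < γ) (hγe : 0 < γe)
    (a b : X → ℝ) (ham : Measurable a) (hbm : Measurable b)
    (hai : Integrable a Px) (hbi : Integrable b Px)
    (ha0 : ∀ x, 0 ≤ a x) (hb0 : ∀ x, 0 ≤ b x) :
    (Real.exp (-Bd / γ) / (2 * γ ^ 2))
        * (∫ x, a x * ∑ y, η x y * (ℓh (x, y) - ∑ y', η x y' * ℓh (x, y')) ^ 2 ∂Px)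
      + (Real.exp (-Bd / γe) / (2 * γe ^ 2))
        * (∫ x, b x * ∑ y, η x y * (ℓe (x, y) - ∑ y', η x y' * ℓe (x, y')) ^ 2 ∂Px)
      ≤ (∫ x, ((∑ y, η x y * Real.exp (-(ℓh (x, y)) / γ)) * a x
            + (∑ y, η x y * Real.exp (-(ℓe (x, y)) / γe)) * b x) ∂Px)
        - (∫ x, (Real.exp (-(∑ y, η x y * ℓh (x, y)) / γ) * a x
            + Real.exp (-(∑ y, η x y * ℓe (x, y)) / γe) * b x) ∂Px)
    ∧ (∫ x, ((∑ y, η x y * Real.exp (-(ℓh (x, y)) / γ)) * a x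
            + (∑ y, η x y * Real.exp (-(ℓe (x, y)) / γe)) * b x) ∂Px)
        - (∫ x, (Real.exp (-(∑ y, η x y * ℓh (x, y)) / γ) * a x
            + Real.exp (-(∑ y, η x y * ℓe (x, y)) / γe) * b x) ∂Px)
      ≤ (1 / (2 * γ ^ 2))
          * (∫ x, a x * ∑ y, η x y * (ℓh (x, y) - ∑ y', η x y' * ℓh (x, y')) ^ 2 ∂Px)
        + (1 / (2 * γe ^ 2))
          * (∫ x, b x * ∑ y, η x y * (ℓe (x, y) - ∑ y', η x y' * ℓe (x, y')) ^ 2 ∂Px) := by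
  obtain ⟨hJh, hEh, hhl, hhu⟩ :=
    weighted_exp_jensen_gap_integral_bounds Px hηm hη0 hη1 hℓhm hℓh hγ hai ha0
  obtain ⟨hJe, hEe, hel, heu⟩ :=
    weighted_exp_jensen_gap_integral_bounds Px hηm hη0 hη1 hℓem hℓe hγe hbi hb0
  rw [integral_add hJh hJe, integral_add hEh hEe]
  constructor <;> linarith
end

section
/- Let (Ω, 𝔽, μ) be a probability space, γ > 0, and Z : Ω → ℝ a random variable such that m ≤ Z ≤ M almost surely for real constants m < M, and E[Z] = 0. Then exp(−M/γ)·Var[Z]/(2γ²) ≤ |E[exp(−Z/γ)] − 1| ≤ exp(−m/γ)·Var[Z]/(2γ²), where Var[Z] = E[Z²]. -/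
open MeasureTheory

/-- Second-order Taylor expansion of the exponential at `0` with Lagrange remainder. -/
theorem Real.exists_exp_eq_one_add_add_exp_mul_sq (x : ℝ) :
    ∃ ξ ∈ Set.uIcc 0 x, Real.exp x = 1 + x + Real.exp ξ * x ^ 2 / 2 := by
  rcases eq_or_ne x 0 with rfl | hx
  · exact ⟨0, by simp, by simp⟩
  · obtain ⟨ξ, hξ, h⟩ := taylor_mean_remainder_lagrange_iteratedDeriv (n := 1) hx.symm
      (Real.contDiff_exp.contDiffOn (s := Set.uIcc 0 x))
    have huniq : UniqueDiffWithinAt ℝ (Set.uIcc 0 x) 0 :=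
      uniqueDiffOn_uIcc hx.symm 0 Set.left_mem_uIcc
    have hd : derivWithin Real.exp (Set.uIcc 0 x) 0 = 1 := by
      rw [Real.differentiableAt_exp.derivWithin huniq, Real.deriv_exp, Real.exp_zero]
    refine ⟨ξ, Set.uIoo_subset_uIcc_self hξ, ?_⟩
    simp [taylorWithinEval_succ, taylor_within_zero_eval, iteratedDerivWithin_one, hd,
      iteratedDeriv_eq_iterate, Real.iter_deriv_exp] at h
    linarith

/-- On an interval containing `0`, the second-order remainder of the exponential is controlled by
the values of the exponential at the endpoints. -/
theorem Real.exp_sub_one_sub_mem_Icc {a b x : ℝ} (ha : a ≤ 0) (hb : 0 ≤ b)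
    (hx : x ∈ Set.Icc a b) :
    Real.exp x - 1 - x ∈ Set.Icc (Real.exp a * x ^ 2 / 2) (Real.exp b * x ^ 2 / 2) := by
  obtain ⟨ξ, hξ, h⟩ := Real.exists_exp_eq_one_add_add_exp_mul_sq x
  have hξ' : ξ ∈ Set.Icc a b := Set.uIcc_subset_Icc ⟨ha, hb⟩ hx hξ
  rw [show Real.exp x - 1 - x = Real.exp ξ * x ^ 2 / 2 by linarith]
  constructor
  · gcongr
    exact hξ'.1
  · gcongr
    exact hξ'.2

/-- Second-order Taylor bounds: for a bounded centered random variable `Z` with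
`m ≤ Z ≤ M` a.s. and `E[Z] = 0`,
`exp(−M/γ)·Var[Z]/(2γ²) ≤ |E[exp(−Z/γ)] − 1| ≤ exp(−m/γ)·Var[Z]/(2γ²)`. -/
theorem taylor_exp_bounds {Ω : Type*} [MeasurableSpace Ω]
    (μ : Measure Ω) [IsProbabilityMeasure μ]
    (γ : ℝ) (hγ : 0 < γ)
    (Z : Ω → ℝ) (hZ : Measurable Z)
    (m M : ℝ) (hmM : m < M)
    (hbd : ∀ᵐ ω ∂μ, Z ω ∈ Set.Icc m M)
    (hmean : ∫ ω, Z ω ∂μ = 0) :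
    Real.exp (-M / γ) * (∫ ω, (Z ω) ^ 2 ∂μ) / (2 * γ ^ 2)
        ≤ |(∫ ω, Real.exp (-(Z ω) / γ) ∂μ) - 1|
      ∧ |(∫ ω, Real.exp (-(Z ω) / γ) ∂μ) - 1|
        ≤ Real.exp (-m / γ) * (∫ ω, (Z ω) ^ 2 ∂μ) / (2 * γ ^ 2) := by
  have hZi : Integrable Z μ := Integrable.of_mem_Icc m M hZ.aemeasurable hbd
  have hm : m ≤ 0 := by
    simpa [hmean] using integral_mono_ae (integrable_const m) hZi (hbd.mono fun _ h => h.1)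
  have hM : 0 ≤ M := by
    simpa [hmean] using integral_mono_ae hZi (integrable_const M) (hbd.mono fun _ h => h.2)
  have hmem : ∀ᵐ ω ∂μ, -(Z ω) / γ ∈ Set.Icc (-M / γ) (-m / γ) := by
    filter_upwards [hbd] with ω h
    exact ⟨by gcongr; exact h.2, by gcongr; exact h.1⟩
  have hei : Integrable (fun ω => Real.exp (-(Z ω) / γ)) μ :=
    Integrable.of_mem_Icc (Real.exp (-M / γ)) (Real.exp (-m / γ)) (by fun_prop)
      (hmem.mono fun _ h => ⟨Real.exp_le_exp.2 h.1, Real.exp_le_exp.2 h.2⟩)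
  have hsq : Integrable (fun ω => Z ω ^ 2) μ :=
    (memLp_of_bounded hbd hZ.aestronglyMeasurable 2).integrable_sq
  have hrem : ∀ᵐ ω ∂μ, Real.exp (-(Z ω) / γ) - 1 - -(Z ω) / γ ∈
      Set.Icc (Real.exp (-M / γ) / (2 * γ ^ 2) * Z ω ^ 2)
        (Real.exp (-m / γ) / (2 * γ ^ 2) * Z ω ^ 2) := by
    filter_upwards [hmem] with ω h
    convert Real.exp_sub_one_sub_mem_Icc (div_nonpos_of_nonpos_of_nonneg (by linarith) hγ.le)
      (div_nonneg (by linarith) hγ.le) h using 2 <;> field_simp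
  have hlin : Integrable (fun ω => -(Z ω) / γ) μ := hZi.neg.div_const γ
  have hsub : Integrable (fun ω => Real.exp (-(Z ω) / γ) - 1) μ := hei.sub (integrable_const 1)
  have hint : ∫ ω, (Real.exp (-(Z ω) / γ) - 1 - -(Z ω) / γ) ∂μ =
      (∫ ω, Real.exp (-(Z ω) / γ) ∂μ) - 1 := by
    rw [integral_sub hsub hlin, integral_sub hei (integrable_const 1), integral_div,
      integral_neg, hmean]
    simp
  have hlower := integral_mono_ae (hsq.const_mul _) (hsub.sub hlin) (hrem.mono fun _ h => h.1)
  have hupper := integral_mono_ae (hsub.sub hlin) (hsq.const_mul _) (hrem.mono fun _ h => h.2)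
  simp only [Pi.sub_apply, hint] at hlower hupper
  rw [integral_const_mul, div_mul_eq_mul_div] at hlower hupper
  have hnonneg : 0 ≤ Real.exp (-M / γ) * (∫ ω, (Z ω) ^ 2 ∂μ) / (2 * γ ^ 2) := by
    have : 0 ≤ ∫ ω, (Z ω) ^ 2 ∂μ := integral_nonneg fun ω => sq_nonneg (Z ω)
    positivity
  rw [abs_of_nonneg (hnonneg.trans hlower)]
  exact ⟨hlower, hupper⟩
end

section
/- Let X be a measurable space with probability measure P_x, L ≥ 1, and η : X → (Fin L → ℝ) a measurable class-posterior (η y x ≥ 0 for all y and ∑_y η y x = 1 for all x). Let f, f_e : X → Fin L be measurable classifiers, and let a, b : X → ℝ be measurable and P_x-integrable with a ≥ 0 and b ≥ 0. For γ > 0 define G(γ) = ∫ ∑_y η y x · ( exp(−(1 − [f(x) = y])/γ)·a(x) + exp(−(1 − [f_e(x) = y])/γ)·b(x) ) dP_x(x), where [·] ∈ {0,1} denotes the indicator. Then G(γ) tends, as γ → 0 from the right, to ∫ ∑_y η y x · ( [f(x) = y]·a(x) + [f_e(x) = y]·b(x) ) dP_x(x). -/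
open MeasureTheory Filter

/-- The zero-one loss factor `exp (-(1 - [p]) / γ)` tends to `[p]` as `γ → 0⁺`. -/
lemma tendsto_exp_neg_zeroOne_div (p : Prop) [Decidable p] :
    Tendsto (fun γ : ℝ => Real.exp (-(1 - (if p then (1:ℝ) else 0)) / γ))
      (nhdsWithin 0 (Set.Ioi 0)) (nhds (if p then (1:ℝ) else 0)) := by
  by_cases hp : p
  · simp [hp]
  · simp only [hp, if_false, sub_zero, neg_div, one_div]
    exact Real.tendsto_exp_neg_atTop_nhds_zero.comp tendsto_inv_nhdsGT_zero

lemma exp_neg_zeroOne_div_le_one (p : Prop) [Decidable p] {γ : ℝ} (hγ : 0 < γ) :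
    Real.exp (-(1 - (if p then (1:ℝ) else 0)) / γ) ≤ 1 := by
  rw [Real.exp_le_one_iff]
  apply div_nonpos_of_nonpos_of_nonneg _ hγ.le
  split_ifs <;> norm_num

/-- As the temperature `γ → 0⁺`, the joint ideal DR CPE loss with the zero-one loss
converges to the correctness-weighted objective. -/
theorem joint_drcpe_zero_one_limit {X : Type*} [MeasurableSpace X]
    (Px : Measure X) [IsProbabilityMeasure Px]
    (L : ℕ) (hL : 1 ≤ L)
    (η : X → Fin L → ℝ) (hηm : Measurable η)
    (hη0 : ∀ x y, 0 ≤ η x y) (hη1 : ∀ x, ∑ y, η x y = 1)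
    (f fe : X → Fin L) (hf : Measurable f) (hfe : Measurable fe)
    (a b : X → ℝ) (ham : Measurable a) (hbm : Measurable b)
    (hai : Integrable a Px) (hbi : Integrable b Px)
    (ha0 : ∀ x, 0 ≤ a x) (hb0 : ∀ x, 0 ≤ b x) :
    Tendsto
      (fun γ : ℝ => ∫ x, ∑ y, η x y *
        (Real.exp (-(1 - (if f x = y then (1:ℝ) else 0)) / γ) * a x
          + Real.exp (-(1 - (if fe x = y then (1:ℝ) else 0)) / γ) * b x) ∂Px)
      (nhdsWithin 0 (Set.Ioi 0))
      (nhds (∫ x, ∑ y, η x y *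
        ((if f x = y then (1:ℝ) else 0) * a x
          + (if fe x = y then (1:ℝ) else 0) * b x) ∂Px)) := by
  apply tendsto_integral_filter_of_dominated_convergence (fun x => a x + b x)
  · refine Eventually.of_forall fun γ => Measurable.aestronglyMeasurable ?_
    refine Finset.measurable_sum _ fun y _ => ?_
    have hind (g : X → Fin L) (hg : Measurable g) :
        Measurable fun x => if g x = y then (1:ℝ) else 0 :=
      Measurable.ite (hg (measurableSet_singleton y)) measurable_const measurable_const
    have := hind f hf
    have := hind fe hfe
    fun_prop
  · filter_upwards [self_mem_nhdsWithin] with γ hγ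
    refine Eventually.of_forall fun x => ?_
    have hterm (y : Fin L) := mul_nonneg (hη0 x y) (add_nonneg
      (mul_nonneg (Real.exp_pos (-(1 - (if f x = y then (1:ℝ) else 0)) / γ)).le (ha0 x))
      (mul_nonneg (Real.exp_pos (-(1 - (if fe x = y then (1:ℝ) else 0)) / γ)).le (hb0 x)))
    rw [Real.norm_of_nonneg (Finset.sum_nonneg fun y _ => hterm y)]
    calc
      _ ≤ ∑ y, η x y * (a x + b x) := by
        refine Finset.sum_le_sum fun y _ => mul_le_mul_of_nonneg_left (add_le_add ?_ ?_) (hη0 x y)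
        · exact mul_le_of_le_one_left (ha0 x) (exp_neg_zeroOne_div_le_one _ hγ)
        · exact mul_le_of_le_one_left (hb0 x) (exp_neg_zeroOne_div_le_one _ hγ)
      _ = a x + b x := by rw [← Finset.sum_mul, hη1, one_mul]
  · exact hai.add hbi
  · refine Eventually.of_forall fun x => tendsto_finsetSum _ fun y _ => ?_
    exact (((tendsto_exp_neg_zeroOne_div _).mul_const _).add
      ((tendsto_exp_neg_zeroOne_div _).mul_const _)).const_mul _
end
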